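/- arXiv:2112.10694 — 2 statements merged into one kernel-verified Lean document; each statement's English description precedes it below -/
import Mathlib

section
/- Let x, y, z, Y, Z be real numbers, all > 1, and let X be a real number. Then (x² − 1)·X² + (y² − 1)·Y² + (z² − 1)·Z² − 2·(x·y + z)·X·Y − 2·(y·z + x)·Y·Z − 2·(x·z + y)·X·Z = x² + y² + z² + 2·x·y·z − 1 holds if and only if X = ((x·y + z)·Y + (x·z + y)·Z + P(x,y,z)·P(x,Y,Z))/(x² − 1) or X = ((x·y + z)·Y + (x·z + y)·Z − P(x,y,z)·P(x,Y,Z))/(x² − 1). -/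
/-- `P a b c = √(a² + b² + c² + 2abc − 1)`. -/
noncomputable def P (a b c : ℝ) : ℝ := Real.sqrt (a ^ 2 + b ^ 2 + c ^ 2 + 2 * a * b * c - 1)

theorem P_sq {a b c : ℝ} (ha : 1 < a) (hb : 1 < b) (hc : 1 < c) :
    P a b c ^ 2 = a ^ 2 + b ^ 2 + c ^ 2 + 2 * a * b * c - 1 := by
  have habc : 0 < a * b * c := by positivity
  exact Real.sq_sqrt (by nlinarith [sq_nonneg b, sq_nonneg c])

theorem stmt_8 (x y z Y Z : ℝ) (hx : 1 < x) (hy : 1 < y) (hz : 1 < z)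
    (hY : 1 < Y) (hZ : 1 < Z) (X : ℝ) :
    ((x ^ 2 - 1) * X ^ 2 + (y ^ 2 - 1) * Y ^ 2 + (z ^ 2 - 1) * Z ^ 2
        - 2 * (x * y + z) * X * Y - 2 * (y * z + x) * Y * Z - 2 * (x * z + y) * X * Z
        = x ^ 2 + y ^ 2 + z ^ 2 + 2 * x * y * z - 1) ↔
      (X = ((x * y + z) * Y + (x * z + y) * Z + P x y z * P x Y Z) / (x ^ 2 - 1) ∨
       X = ((x * y + z) * Y + (x * z + y) * Z - P x y z * P x Y Z) / (x ^ 2 - 1)) := by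
  have hx0 : x ^ 2 - 1 ≠ 0 := by nlinarith
  have key : (x ^ 2 - 1) * (((x ^ 2 - 1) * X ^ 2 + (y ^ 2 - 1) * Y ^ 2 + (z ^ 2 - 1) * Z ^ 2
        - 2 * (x * y + z) * X * Y - 2 * (y * z + x) * Y * Z - 2 * (x * z + y) * X * Z)
        - (x ^ 2 + y ^ 2 + z ^ 2 + 2 * x * y * z - 1))
      = (X * (x ^ 2 - 1) - ((x * y + z) * Y + (x * z + y) * Z)) ^ 2
        - (P x y z * P x Y Z) ^ 2 := by
    rw [mul_pow, P_sq hx hy hz, P_sq hx hY hZ]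
    ring
  rw [eq_div_iff hx0, eq_div_iff hx0, ← sub_eq_zero, ← mul_eq_zero_iff_left hx0, key,
    sub_eq_zero, sq_eq_sq_iff_eq_or_eq_neg, sub_eq_iff_eq_add', sub_eq_iff_eq_add',
    ← sub_eq_add_neg]
end

section
/- (Basmajian's identity for T₁.) Let (Φ, e) be a harmonic weight map on T₁ such that sup{ e(r,s) : (r,s) a Farey pair } < ∞. Then the family ( log((Φ(q)+1)/(Φ(q)−1)) )_{q ∈ ℚ ∩ [0,1]} is summable and ∑_{q ∈ ℚ ∩ [0,1]} log((Φ(q)+1)/(Φ(q)−1)) = h(Φ(0)) + h(Φ(1)) + f(e(0,1), Φ(0), Φ(1)). -/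
/-- `arccosh x = log (x + √(x² − 1))`. -/
noncomputable def arccosh (x : ℝ) : ℝ := Real.log (x + Real.sqrt (x ^ 2 - 1))

/-- `f x Y Z = arccosh ((x + Y·Z)/√((Y²−1)(Z²−1)))`. -/
noncomputable def f (x Y Z : ℝ) : ℝ :=
  arccosh ((x + Y * Z) / Real.sqrt ((Y ^ 2 - 1) * (Z ^ 2 - 1)))

/-- `h X = (1/2)·log((X+1)/(X−1))`. -/
noncomputable def h (X : ℝ) : ℝ := (1 / 2) * Real.log ((X + 1) / (X - 1))

/-- `(r, s)` is a Farey pair: `0 ≤ r < s ≤ 1` and, writing `r = p/q`, `s = m/n`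
in lowest terms, `q·m − p·n = 1`. -/
def IsFareyPair (r s : ℚ) : Prop :=
  0 ≤ r ∧ r < s ∧ s ≤ 1 ∧ (r.den : ℤ) * s.num - r.num * (s.den : ℤ) = 1

/-- The mediant `(p+m)/(q+n)` of the Farey pair `(p/q, m/n)`. -/
def mediant (r s : ℚ) : ℚ := ((r.num + s.num : ℤ) : ℚ) / ((r.den + s.den : ℕ) : ℚ)

theorem IsFareyPair.num_mediant {r s : ℚ} (hrs : IsFareyPair r s) :
    (mediant r s).num = r.num + s.num ∧ (mediant r s).den = r.den + s.den := by
  obtain ⟨-, -, -, hdet⟩ := hrs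
  have hcop : Nat.Coprime (r.num + s.num).natAbs ((r.den + s.den : ℕ) : ℤ).natAbs := by
    rw [← Int.isCoprime_iff_nat_coprime]
    exact ⟨r.den, -r.num, by push_cast; linarith⟩
  have hpos : (0 : ℤ) < ((r.den + s.den : ℕ) : ℤ) := by
    have := r.den_pos
    omega
  refine ⟨Rat.num_div_eq_of_coprime hpos hcop, ?_⟩
  exact Nat.cast_injective (R := ℤ) (Rat.den_div_eq_of_coprime hpos hcop)

theorem IsFareyPair.mediant_mem_Ioo {r s : ℚ} (hrs : IsFareyPair r s) :
    mediant r s ∈ Set.Ioo r s := by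
  obtain ⟨hn, hd⟩ := hrs.num_mediant
  obtain ⟨-, -, -, hdet⟩ := hrs
  rw [Set.mem_Ioo, Rat.lt_iff, Rat.lt_iff, hn, hd]
  push_cast
  constructor <;> linarith

theorem IsFareyPair.left_mediant {r s : ℚ} (hrs : IsFareyPair r s) :
    IsFareyPair r (mediant r s) := by
  obtain ⟨hn, hd⟩ := hrs.num_mediant
  have hm := hrs.mediant_mem_Ioo
  obtain ⟨hr, -, hs, hdet⟩ := hrs
  refine ⟨hr, hm.1, hm.2.le.trans hs, ?_⟩
  rw [hn, hd]
  push_cast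
  linarith

theorem IsFareyPair.mediant_right {r s : ℚ} (hrs : IsFareyPair r s) :
    IsFareyPair (mediant r s) s := by
  obtain ⟨hn, hd⟩ := hrs.num_mediant
  have hm := hrs.mediant_mem_Ioo
  obtain ⟨hr, -, hs, hdet⟩ := hrs
  refine ⟨hr.trans hm.1.le, hm.2, hs, ?_⟩
  rw [hn, hd]
  push_cast
  linarith

theorem isFareyPair_zero_one : IsFareyPair 0 1 := by
  simp [IsFareyPair]

/-- A rational strictly between the members of a Farey pair has denominator at least the sum of
the two denominators. -/
theorem IsFareyPair.den_add_den_le {r s q : ℚ} (hrs : IsFareyPair r s) (hq : q ∈ Set.Ioo r s) :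
    r.den + s.den ≤ q.den := by
  obtain ⟨-, -, -, hdet⟩ := hrs
  obtain ⟨h1, h2⟩ := hq
  rw [Rat.lt_iff] at h1 h2
  have hr : (0 : ℤ) < r.den := by exact_mod_cast r.den_pos
  have hs : (0 : ℤ) < s.den := by exact_mod_cast s.den_pos
  have key : (q.den : ℤ) = r.den * (s.num * q.den - q.num * s.den) +
      s.den * (q.num * r.den - r.num * q.den) := by
    linear_combination (-(q.den : ℤ)) * hdet
  have : (r.den : ℤ) + s.den ≤ q.den := by nlinarith
  exact_mod_cast this

/-- The rationals obtained from the pair `(r, s)` by at most `n` rounds of inserting mediants. -/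
def iteratedMediants : ℕ → ℚ → ℚ → Finset ℚ
  | 0, _, _ => ∅
  | n + 1, r, s =>
    insert (mediant r s) (iteratedMediants n r (mediant r s) ∪ iteratedMediants n (mediant r s) s)

theorem IsFareyPair.iteratedMediants_subset (n : ℕ) {r s : ℚ} (hrs : IsFareyPair r s) :
    ∀ q ∈ iteratedMediants n r s, q ∈ Set.Ioo r s := by
  induction n generalizing r s with
  | zero => simp [iteratedMediants]
  | succ n ih =>
    intro q hq
    have hm := hrs.mediant_mem_Ioo
    simp only [iteratedMediants, Finset.mem_insert, Finset.mem_union] at hq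
    rcases hq with rfl | hq | hq
    · exact hm
    · exact Set.Ioo_subset_Ioo_right hm.2.le (ih hrs.left_mediant q hq)
    · exact Set.Ioo_subset_Ioo_left hm.1.le (ih hrs.mediant_right q hq)

theorem IsFareyPair.mem_iteratedMediants (n : ℕ) {r s q : ℚ} (hrs : IsFareyPair r s)
    (hq : q ∈ Set.Ioo r s) (hn : q.den < n + (r.den + s.den)) : q ∈ iteratedMediants n r s := by
  induction n generalizing r s with
  | zero =>
    have := hrs.den_add_den_le hq
    omega
  | succ n ih =>
    have hd := hrs.num_mediant.2
    have hr := r.den_pos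
    have hs := s.den_pos
    simp only [iteratedMediants, Finset.mem_insert, Finset.mem_union]
    rcases lt_trichotomy q (mediant r s) with hlt | heq | hgt
    · exact Or.inr (Or.inl (ih hrs.left_mediant ⟨hq.1, hlt⟩ (by omega)))
    · exact Or.inl heq
    · exact Or.inr (Or.inr (ih hrs.mediant_right ⟨hgt, hq.2⟩ (by omega)))

theorem IsFareyPair.sum_iteratedMediants_succ (w : ℚ → ℝ) (n : ℕ) {r s : ℚ}
    (hrs : IsFareyPair r s) :
    ∑ q ∈ iteratedMediants (n + 1) r s, w q =
      w (mediant r s) + (∑ q ∈ iteratedMediants n r (mediant r s), w q +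
        ∑ q ∈ iteratedMediants n (mediant r s) s, w q) := by
  have hl := hrs.left_mediant.iteratedMediants_subset n
  have hr := hrs.mediant_right.iteratedMediants_subset n
  rw [iteratedMediants, Finset.sum_insert, Finset.sum_union]
  · exact Finset.disjoint_left.2 fun q h1 h2 => lt_asymm (hl q h1).2 (hr q h2).1
  · rw [Finset.mem_union, not_or]
    exact ⟨fun h1 => (hl _ h1).2.false, fun h1 => (hr _ h1).1.false⟩

/-- If `ε` is a nonnegative function on Farey pairs which loses `w m` when passing from a pair to
its two children with common member `m`, and what remains is at most `C * w m`, then `ε r s` is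
the total weight of the open interval `(r, s)`. -/
theorem IsFareyPair.hasSum_Ioo {w : ℚ → ℝ} {ε : ℚ → ℚ → ℝ} {C : ℝ} (hC : 0 ≤ C)
    (hw : ∀ q ∈ Set.Icc (0 : ℚ) 1, 0 ≤ w q)
    (hε : ∀ r s, IsFareyPair r s → 0 ≤ ε r s)
    (hadd : ∀ r s, IsFareyPair r s →
      ε r s = ε r (mediant r s) + ε (mediant r s) s + w (mediant r s))
    (hle : ∀ r s, IsFareyPair r s →
      ε r (mediant r s) + ε (mediant r s) s ≤ C * w (mediant r s))
    {r s : ℚ} (hrs : IsFareyPair r s) :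
    HasSum (fun q : Set.Ioo r s => w q) (ε r s) := by
  have hsub : Set.Ioo r s ⊆ Set.Icc 0 1 := fun q hq =>
    ⟨hrs.1.trans hq.1.le, hq.2.le.trans hrs.2.2.1⟩
  have upper : ∀ n r s, IsFareyPair r s → ∑ q ∈ iteratedMediants n r s, w q ≤ ε r s := by
    intro n
    induction n with
    | zero => intro r s hrs; simpa [iteratedMediants] using hε r s hrs
    | succ n ih =>
      intro r s hrs
      rw [hrs.sum_iteratedMediants_succ, hadd r s hrs]
      linarith [ih _ _ hrs.left_mediant, ih _ _ hrs.mediant_right]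
  have lower : ∀ n r s, IsFareyPair r s →
      ε r s - ∑ q ∈ iteratedMediants n r s, w q ≤ (C / (1 + C)) ^ n * ε r s := by
    intro n
    induction n with
    | zero => intro r s _; simp [iteratedMediants]
    | succ n ih =>
      intro r s hrs
      have hcontr : ε r (mediant r s) + ε (mediant r s) s ≤ C / (1 + C) * ε r s := by
        rw [div_mul_eq_mul_div, le_div_iff₀ (by linarith)]
        have := hle r s hrs
        rw [hadd r s hrs]
        linarith
      have hpow : 0 ≤ (C / (1 + C)) ^ n := by positivity
      rw [hrs.sum_iteratedMediants_succ, pow_succ, mul_assoc]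
      have h1 := ih _ _ hrs.left_mediant
      have h2 := ih _ _ hrs.mediant_right
      have h3 := mul_le_mul_of_nonneg_left hcontr hpow
      have h4 := hadd r s hrs
      linarith
  refine hasSum_of_isLUB_of_nonneg _ (fun q => hw q (hsub q.2)) ⟨?_, ?_⟩
  · rintro _ ⟨T, rfl⟩
    refine le_trans ?_ (upper (T.sup fun q => (q : ℚ).den) r s hrs)
    refine (Finset.sum_map T (Function.Embedding.subtype _) w).symm.le.trans ?_
    refine Finset.sum_le_sum_of_subset_of_nonneg ?_ fun q hq _ =>
      hw q (hsub (hrs.iteratedMediants_subset _ q hq))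
    intro q hq
    obtain ⟨p, hp, rfl⟩ := Finset.mem_map.1 hq
    refine hrs.mem_iteratedMediants _ p.2 ?_
    have h1 : (p : ℚ).den ≤ T.sup fun q => (q : ℚ).den :=
      Finset.le_sup (f := fun q : Set.Ioo r s => (q : ℚ).den) hp
    have h2 := r.den_pos
    change (p : ℚ).den < _
    omega
  · intro b hb
    have hbn : ∀ n, ε r s - (C / (1 + C)) ^ n * ε r s ≤ b := by
      intro n
      have h1 := hb ⟨(iteratedMediants n r s).subtype (· ∈ Set.Ioo r s), rfl⟩
      change ∑ q ∈ (iteratedMediants n r s).subtype (· ∈ Set.Ioo r s), w q ≤ b at h1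
      rw [Finset.sum_subtype_of_mem w (hrs.iteratedMediants_subset n)] at h1
      linarith [lower n r s hrs]
    have hlim : Filter.Tendsto (fun n : ℕ => ε r s - (C / (1 + C)) ^ n * ε r s) Filter.atTop
        (nhds (ε r s - 0 * ε r s)) := by
      refine ((tendsto_pow_atTop_nhds_zero_of_lt_one (by positivity) ?_).mul_const _).const_sub _
      rw [div_lt_one (by linarith)]
      linarith
    simpa using le_of_tendsto' hlim hbn

theorem h_pos {X : ℝ} (hX : 1 < X) : 0 < h X := by
  have : 1 < (X + 1) / (X - 1) := by
    rw [one_lt_div (by linarith)]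
    linarith
  have := Real.log_pos this
  unfold h
  linarith

theorem exp_h_sq {X : ℝ} (hX : 1 < X) : Real.exp (h X) ^ 2 = (X + 1) / (X - 1) := by
  have : 0 < (X + 1) / (X - 1) := div_pos (by linarith) (by linarith)
  rw [← Real.exp_nat_mul, h, ← Real.exp_log this, Real.log_exp]
  push_cast
  ring_nf

theorem mul_sinh_h {X : ℝ} (hX : 1 < X) : X * Real.sinh (h X) = Real.cosh (h X) := by
  have h1 := exp_h_sq hX
  have h2 := Real.exp_pos (h X)
  rw [eq_div_iff (by linarith)] at h1
  rw [Real.sinh_eq, Real.cosh_eq, Real.exp_neg]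
  field_simp
  linarith

theorem cosh_f {x Y Z : ℝ} (hx : 1 < x) (hY : 1 < Y) (hZ : 1 < Z) :
    0 ≤ f x Y Z ∧ Real.cosh (f x Y Z) =
      x * (Real.sinh (h Y) * Real.sinh (h Z)) + Real.cosh (h Y) * Real.cosh (h Z) := by
  have hsY := Real.sinh_pos_iff.2 (h_pos hY)
  have hsZ := Real.sinh_pos_iff.2 (h_pos hZ)
  have hY2 : (Y ^ 2 - 1) * Real.sinh (h Y) ^ 2 = 1 := by
    have := Real.cosh_sq (h Y)
    rw [← mul_sinh_h hY] at this
    linarith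
  have hZ2 : (Z ^ 2 - 1) * Real.sinh (h Z) ^ 2 = 1 := by
    have := Real.cosh_sq (h Z)
    rw [← mul_sinh_h hZ] at this
    linarith
  have hsqrt : Real.sqrt ((Y ^ 2 - 1) * (Z ^ 2 - 1)) =
      (Real.sinh (h Y) * Real.sinh (h Z))⁻¹ := by
    have hsq : (Y ^ 2 - 1) * (Z ^ 2 - 1) = (Real.sinh (h Y) * Real.sinh (h Z))⁻¹ ^ 2 := by
      rw [inv_pow]
      refine eq_inv_of_mul_eq_one_left ?_
      linear_combination (Z ^ 2 - 1) * Real.sinh (h Z) ^ 2 * hY2 + hZ2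
    rw [hsq, Real.sqrt_sq (by positivity)]
  have harg : (x + Y * Z) / Real.sqrt ((Y ^ 2 - 1) * (Z ^ 2 - 1)) =
      x * (Real.sinh (h Y) * Real.sinh (h Z)) + Real.cosh (h Y) * Real.cosh (h Z) := by
    rw [hsqrt, div_inv_eq_mul, ← mul_sinh_h hY, ← mul_sinh_h hZ]
    ring
  have hone : 1 ≤ x * (Real.sinh (h Y) * Real.sinh (h Z)) +
      Real.cosh (h Y) * Real.cosh (h Z) := by
    have h1 := mul_pos hsY hsZ
    nlinarith [Real.one_le_cosh (h Y), Real.one_le_cosh (h Z)]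
  have hf : f x Y Z = Real.arcosh (x * (Real.sinh (h Y) * Real.sinh (h Z)) +
      Real.cosh (h Y) * Real.cosh (h Z)) := by
    rw [← harg]
    rfl
  rw [hf]
  exact ⟨Real.arcosh_nonneg hone, Real.cosh_arcosh hone⟩

theorem f_comm (x Y Z : ℝ) : f x Y Z = f x Z Y := by
  simp only [f, mul_comm]

theorem h_add_h_le_f {x Y Z : ℝ} (hx : 1 < x) (hY : 1 < Y) (hZ : 1 < Z) :
    h Y + h Z ≤ f x Y Z := by
  obtain ⟨h0, hc⟩ := cosh_f hx hY hZ
  have hab : 0 ≤ h Y + h Z := (add_pos (h_pos hY) (h_pos hZ)).le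
  rw [← abs_of_nonneg h0, ← abs_of_nonneg hab, ← Real.cosh_le_cosh, hc, Real.cosh_add]
  have := mul_pos (Real.sinh_pos_iff.2 (h_pos hY)) (Real.sinh_pos_iff.2 (h_pos hZ))
  nlinarith

theorem sinh_le_two_mul_mul_cosh {a : ℝ} (ha : 0 ≤ a) : Real.sinh a ≤ 2 * a * Real.cosh a := by
  have h1 := Real.add_one_le_exp (-(2 * a))
  have h2 : Real.exp (-a) = Real.exp a * Real.exp (-(2 * a)) := by
    rw [← Real.exp_add]
    ring_nf
  have h3 := Real.exp_pos a
  have h4 := Real.exp_pos (-a)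
  rw [Real.sinh_eq, Real.cosh_eq]
  nlinarith [mul_nonneg ha h4.le]

/-- The excess of `f x Y Z` over its value at `x = 1` is controlled by `h Y`. -/
theorem f_le {x Y Z : ℝ} (hx : 1 < x) (hY : 1 < Y) (hZ : 1 < Z) :
    f x Y Z - h Y - h Z ≤ (x - 1) * (2 * h Y) := by
  have hle := h_add_h_le_f hx hY hZ
  obtain ⟨-, hc⟩ := cosh_f hx hY hZ
  have ha := h_pos hY
  have hb := h_pos hZ
  have hsa := Real.sinh_pos_iff.2 ha
  have hsb := Real.sinh_pos_iff.2 hb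
  have hca := Real.cosh_pos (h Y)
  obtain ⟨t, ht⟩ : ∃ t, t = f x Y Z - h Y - h Z := ⟨_, rfl⟩
  have ht0 : 0 ≤ t := by linarith
  rw [← ht]
  rw [show f x Y Z = (h Y + h Z) + t by linarith, Real.cosh_add] at hc
  have h1 : Real.cosh (h Y + h Z) ≤ Real.cosh (h Y + h Z) * Real.cosh t :=
    le_mul_of_one_le_right (Real.cosh_pos _).le (Real.one_le_cosh t)
  have hs : Real.cosh (h Y) * Real.sinh (h Z) ≤ Real.sinh (h Y + h Z) := by
    rw [Real.sinh_add]
    linarith [mul_pos hsa (Real.cosh_pos (h Z))]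
  have h2 : Real.cosh (h Y) * Real.sinh (h Z) * t ≤ Real.sinh (h Y + h Z) * Real.sinh t :=
    mul_le_mul hs (Real.self_le_sinh_iff.2 ht0) ht0 ((mul_pos hca hsb).le.trans hs)
  have h3 : Real.cosh (h Y + h Z) =
      Real.cosh (h Y) * Real.cosh (h Z) + Real.sinh (h Y) * Real.sinh (h Z) := Real.cosh_add _ _
  have h4 : (t * Real.cosh (h Y)) * Real.sinh (h Z) ≤
      ((x - 1) * Real.sinh (h Y)) * Real.sinh (h Z) := by linarith
  have h5 := le_of_mul_le_mul_right h4 hsb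
  have h6 := mul_le_mul_of_nonneg_left (sinh_le_two_mul_mul_cosh ha.le)
    (by linarith : (0 : ℝ) ≤ x - 1)
  refine le_of_mul_le_mul_right ?_ hca
  linarith

theorem stmt_10 (Φ : ℚ → ℝ) (e : ℚ → ℚ → ℝ)
    (hΦ : ∀ q ∈ Set.Icc (0 : ℚ) 1, 1 < Φ q)
    (he : ∀ r s, IsFareyPair r s → 1 < e r s)
    (hharm : ∀ r s, IsFareyPair r s →
      f (e r s) (Φ r) (Φ s) =
        f (e r (mediant r s)) (Φ r) (Φ (mediant r s)) +
        f (e (mediant r s) s) (Φ (mediant r s)) (Φ s))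
    (hsup : ∃ M : ℝ, ∀ r s, IsFareyPair r s → e r s ≤ M) :
    Summable (fun q : {q : ℚ // q ∈ Set.Icc (0 : ℚ) 1} =>
        Real.log ((Φ q + 1) / (Φ q - 1))) ∧
      ∑' q : {q : ℚ // q ∈ Set.Icc (0 : ℚ) 1}, Real.log ((Φ q + 1) / (Φ q - 1)) =
        h (Φ 0) + h (Φ 1) + f (e 0 1) (Φ 0) (Φ 1) := by
  obtain ⟨M, hM⟩ := hsup
  have hM1 : 1 < M := (he _ _ isFareyPair_zero_one).trans_le (hM _ _ isFareyPair_zero_one)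
  have hwh : ∀ q, Real.log ((Φ q + 1) / (Φ q - 1)) = 2 * h (Φ q) := fun q => by
    unfold h
    ring
  simp only [hwh]
  have hl : ∀ {r s}, IsFareyPair r s → 1 < Φ r := fun {r s} hrs =>
    hΦ r ⟨hrs.1, hrs.2.1.le.trans hrs.2.2.1⟩
  have hr : ∀ {r s}, IsFareyPair r s → 1 < Φ s := fun {r s} hrs =>
    hΦ s ⟨hrs.1.trans hrs.2.1.le, hrs.2.2.1⟩
  have hbound : ∀ {r s} X, IsFareyPair r s → 1 < X →
      (e r s - 1) * (2 * h X) ≤ (M - 1) * (2 * h X) := fun {r s} X hrs hX =>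
    mul_le_mul_of_nonneg_right (by linarith [hM r s hrs]) (by linarith [h_pos hX])
  have hIoo : HasSum (fun q : Set.Ioo (0 : ℚ) 1 => 2 * h (Φ q))
      (f (e 0 1) (Φ 0) (Φ 1) - h (Φ 0) - h (Φ 1)) := by
    refine isFareyPair_zero_one.hasSum_Ioo (w := fun q => 2 * h (Φ q))
      (ε := fun r s => f (e r s) (Φ r) (Φ s) - h (Φ r) - h (Φ s)) (C := 2 * (M - 1))
      (by linarith) (fun q hq => by linarith [h_pos (hΦ q hq)]) ?_ ?_ ?_
    · intro r s hrs
      linarith [h_add_h_le_f (he r s hrs) (hl hrs) (hr hrs)]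
    · intro r s hrs
      linarith [hharm r s hrs]
    · intro r s hrs
      have hrm := hrs.left_mediant
      have hms := hrs.mediant_right
      have h1 := f_le (he _ _ hrm) (hr hrm) (hl hrm)
      rw [f_comm] at h1
      have h2 := f_le (he _ _ hms) (hl hms) (hr hms)
      have h3 := hbound _ hrm (hr hrm)
      have h4 := hbound _ hms (hr hrm)
      linarith
  have hends : HasSum ((fun q : ℚ => 2 * h (Φ q)) ∘ (↑) : (({0, 1} : Finset ℚ) : Set ℚ) → ℝ)
      (2 * h (Φ 0) + 2 * h (Φ 1)) := by
    have := Finset.hasSum ({0, 1} : Finset ℚ) (fun q => 2 * h (Φ q))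
    rwa [Finset.sum_pair zero_ne_one] at this
  have hdisj : Disjoint (Set.Ioo (0 : ℚ) 1) (({0, 1} : Finset ℚ) : Set ℚ) := by
    simp
  have hunion : Set.Ioo (0 : ℚ) 1 ∪ (({0, 1} : Finset ℚ) : Set ℚ) = Set.Icc 0 1 := by
    rw [Finset.coe_pair, Set.Ioo_union_both zero_le_one]
  have hsum := HasSum.add_disjoint hdisj (f := fun q : ℚ => 2 * h (Φ q)) hIoo hends
  rw [hunion] at hsum
  refine ⟨hsum.summable, hsum.tsum_eq.trans ?_⟩
  ring
end
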